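/- arXiv:2510.15758 — 3 statements merged into one kernel-verified Lean document; each statement's English description precedes it below -/
import Mathlib

section
/- Let K be an imaginary quadratic field and S a finite nonempty set of finite places of K, with O_{K,S} the ring of S-integers. There exist a rational prime p and an integer b with 0 < b < p such that for every x ∈ O_{K,S}, the element p·x + b is not a unit of O_{K,S}. -/
open IsDedekindDomain NumberField

open Polynomial in
/-- The values of a nonconstant integer polynomial have prime divisors coprime to any given
nonzero integer. -/
theorem Polynomial.exists_prime_dvd_eval_not_dvd (f : ℤ[X]) (hf : 0 < f.natDegree) (N : ℤ)
    (hN : N ≠ 0) : ∃ p : ℕ, p.Prime ∧ ¬ (p : ℤ) ∣ N ∧ ∃ n : ℤ, (p : ℤ) ∣ f.eval n := by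
  by_cases hc : f.eval 0 = 0
  · obtain ⟨p, hpN, hp⟩ := Nat.exists_infinite_primes (N.natAbs + 1)
    refine ⟨p, hp, fun h => ?_, 0, by simp [hc]⟩
    have := Nat.le_of_dvd (Int.natAbs_pos.mpr hN) (Int.natCast_dvd.mp h)
    omega
  set c := f.eval 0 with hcdef
  have hne (a : ℤ) : f - C a ≠ 0 := fun h => by
    rw [sub_eq_zero.mp h, natDegree_C] at hf
    exact hf.false
  obtain ⟨t, ht⟩ : ∃ t : ℤ, ¬ ((f - C c) * (f - C (-c))).IsRoot (c * N * t) := by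
    by_contra! h
    refine mul_ne_zero (hne c) (hne (-c)) (eq_zero_of_infinite_isRoot _ ?_)
    refine (Set.infinite_range_of_injective
      (mul_right_injective₀ (mul_ne_zero hc hN))).mono ?_
    rintro _ ⟨t, rfl⟩
    exact h t
  obtain ⟨k, hk⟩ : c * N * t ∣ f.eval (c * N * t) - c := by
    simpa using sub_dvd_eval_sub (c * N * t) 0 f
  have hval : f.eval (c * N * t) = c * (1 + N * (t * k)) := by linear_combination hk
  have hunit : (1 + N * (t * k)).natAbs ≠ 1 := fun h => by
    apply ht
    rcases Int.natAbs_eq_iff.mp h with h | h <;> simp [hval, h]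
  obtain ⟨p, hp, hpd⟩ := Nat.exists_prime_and_dvd hunit
  rw [← Int.natCast_dvd] at hpd
  refine ⟨p, hp, fun h => ?_, c * N * t, hval ▸ hpd.mul_left c⟩
  have h1 : (p : ℤ) ∣ 1 := (dvd_add_left (h.mul_right (t * k))).mp hpd
  exact hp.one_lt.ne' (by exact_mod_cast Int.eq_one_of_dvd_one (by positivity) h1)

open Polynomial in
/-- Finitely many nonconstant integer polynomials have roots simultaneously modulo some prime not
dividing a given nonzero integer. -/
theorem Polynomial.exists_prime_forall_exists_root_zmod (s : Finset ℤ[X])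
    (hs : ∀ F ∈ s, 0 < F.natDegree) (N : ℤ) (hN : N ≠ 0) :
    ∃ p : ℕ, p.Prime ∧ ¬ (p : ℤ) ∣ N ∧ ∀ F ∈ s, ∃ y : ZMod p, aeval y F = 0 := by
  let P : ℚ[X] := ∏ F ∈ s, F.map (algebraMap ℤ ℚ)
  have hP : P ≠ 0 := Finset.prod_ne_zero_iff.mpr fun F hF =>
    (Polynomial.map_ne_zero_iff (algebraMap ℤ ℚ).injective_int).mpr
      (ne_zero_of_natDegree_gt (hs F hF))
  let L := P.SplittingField
  have : FiniteDimensional ℚ L := inferInstanceAs (FiniteDimensional ℚ P.SplittingField)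
  have hroot (F) (hF : F ∈ s) : ∃ y : L, aeval y F = 0 := by
    have hdvd : F.map (algebraMap ℤ ℚ) ∣ P := Finset.dvd_prod_of_mem _ hF
    have hsp := ((SplittingField.splits P).of_dvd (map_ne_zero hP)
      (Polynomial.map_dvd (algebraMap ℚ L) hdvd))
    obtain ⟨y, hy⟩ := hsp.exists_eval_eq_zero (by
      rw [degree_map, degree_map_eq_of_injective (algebraMap ℤ ℚ).injective_int]
      exact (natDegree_pos_iff_degree_pos.mp (hs F hF)).ne')
    refine ⟨y, ?_⟩
    rw [eval_map_algebraMap, aeval_map_algebraMap] at hy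
    exact hy
  obtain ⟨θ₀, hθ₀⟩ := Field.exists_primitive_element ℚ L
  have halg : IsAlgebraic ℤ θ₀ :=
    (IsFractionRing.isAlgebraic_iff ℤ ℚ L).mpr (Algebra.IsAlgebraic.isAlgebraic θ₀)
  obtain ⟨d, hd, hint⟩ := halg.exists_integral_multiple
  -- every element of `L` is, up to an integer denominator, an integer polynomial in `θ`
  set θ := d • θ₀ with hθ
  have hpoly (y : L) : ∃ D : ℤ, D ≠ 0 ∧ ∃ g : ℤ[X], (D : L) * y = aeval θ g := by
    have hy : y ∈ Algebra.adjoin ℚ {θ} := by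
      rw [← IntermediateField.adjoin_simple_toSubalgebra_of_isAlgebraic
        (Algebra.IsAlgebraic.isAlgebraic θ)]
      have : (⊤ : IntermediateField ℚ L) ≤ IntermediateField.adjoin ℚ {θ} := by
        rw [← hθ₀, IntermediateField.adjoin_simple_le_iff]
        have h1 : θ₀ = (d : ℚ)⁻¹ • θ := by
          rw [hθ, ← Int.cast_smul_eq_zsmul ℚ, smul_smul,
            inv_mul_cancel₀ (by exact_mod_cast hd), one_smul]
        rw [h1]
        exact (IntermediateField.adjoin ℚ {θ}).smul_mem
          (IntermediateField.mem_adjoin_simple_self ℚ θ)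
      exact this trivial
    rw [Algebra.adjoin_singleton_eq_range_aeval] at hy
    obtain ⟨G, rfl⟩ := hy
    obtain ⟨D, hD, h⟩ := IsLocalization.integerNormalization_spec (nonZeroDivisors ℤ) G
    refine ⟨D, nonZeroDivisors.ne_zero hD,
      IsLocalization.integerNormalization (nonZeroDivisors ℤ) G, ?_⟩
    rw [← aeval_map_algebraMap ℚ, h]
    simp
  choose! root hroot using hroot
  choose D hD g hg using hpoly
  have hdeg : 0 < (minpoly ℤ θ).natDegree := minpoly.natDegree_pos hint
  obtain ⟨p, hp, hpN, n, hn⟩ := (minpoly ℤ θ).exists_prime_dvd_eval_not_dvd hdeg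
    (N * ∏ F ∈ s, D (root F)) (mul_ne_zero hN (Finset.prod_ne_zero_iff.mpr fun F _ => hD _))
  refine ⟨p, hp, fun h => hpN (h.mul_right _), fun F hF => ?_⟩
  have := Fact.mk hp
  have hpD : ((D (root F) : ℤ) : ZMod p) ≠ 0 := fun h => by
    rw [ZMod.intCast_zmod_eq_zero_iff_dvd] at h
    exact hpN ((h.trans (Finset.dvd_prod_of_mem (fun F => D (root F)) hF)).mul_left N)
  have hdvd : minpoly ℤ θ ∣ (F.scaleRoots (D (root F))).comp (g (root F)) := by
    apply minpoly.isIntegrallyClosed_dvd hint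
    rw [aeval_comp, ← hg]
    exact scaleRoots_aeval_eq_zero (hroot F hF)
  have hz : aeval (n : ZMod p) ((F.scaleRoots (D (root F))).comp (g (root F))) = 0 := by
    have h0 : aeval (n : ZMod p) (minpoly ℤ θ) = 0 := by
      have := aeval_algebraMap_apply (ZMod p) n (minpoly ℤ θ)
      simp only [algebraMap_int_eq, eq_intCast, coe_aeval_eq_eval] at this
      rw [this]
      exact (ZMod.intCast_zmod_eq_zero_iff_dvd _ _).mpr hn
    exact aeval_eq_zero_of_dvd_aeval_eq_zero hdvd h0
  refine ⟨(D (root F) : ZMod p)⁻¹ * aeval (n : ZMod p) (g (root F)), ?_⟩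
  have hs := scaleRoots_eval₂_mul (p := F) (algebraMap ℤ (ZMod p))
    ((D (root F) : ZMod p)⁻¹ * aeval (n : ZMod p) (g (root F))) (D (root F))
  rw [eq_intCast, mul_inv_cancel_left₀ hpD, ← aeval_def, ← aeval_comp, hz] at hs
  exact (mul_eq_zero.mp hs.symm).resolve_left (pow_ne_zero _ hpD)

open Polynomial in
/-- There is a prime modulo which every prime divisor of `M` is a nonzero cube but not every
residue is a cube. -/
theorem exists_prime_cubes_zmod (M : ℕ) (hM : M ≠ 0) :
    ∃ p : ℕ, p.Prime ∧ ¬ p ∣ M ∧ (∀ q : ℕ, q.Prime → q ∣ M → ∃ y : ZMod p, y ^ 3 = q) ∧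
      ∃ b : ZMod p, ∀ y : ZMod p, y ^ 3 ≠ b := by
  classical
  obtain ⟨p, hp, hpN, h⟩ := exists_prime_forall_exists_root_zmod
    (insert (X ^ 2 + X + 1) (M.primeFactors.image fun q : ℕ => X ^ 3 - C (q : ℤ))) (by
      intro F hF
      rcases Finset.mem_insert.mp hF with rfl | hF
      · have : (X ^ 2 + X + 1 : ℤ[X]).natDegree = 2 := by compute_degree!
        omega
      · obtain ⟨q, -, rfl⟩ := Finset.mem_image.mp hF
        rw [natDegree_X_pow_sub_C]
        norm_num) (3 * M : ℤ) (by positivity)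
  have := Fact.mk hp
  refine ⟨p, hp, fun hpM => hpN ((Int.natCast_dvd_natCast.mpr hpM).mul_left 3), ?_, ?_⟩
  · intro q hq hqM
    obtain ⟨y, hy⟩ := h _ (Finset.mem_insert_of_mem
      (Finset.mem_image_of_mem _ (Nat.mem_primeFactors.mpr ⟨hq, hqM, hM⟩)))
    exact ⟨y, by simpa [sub_eq_zero] using hy⟩
  · obtain ⟨r, hr⟩ := h _ (Finset.mem_insert_self _ _)
    have hr : r ^ 2 + r + 1 = 0 := by simpa using hr
    by_contra! hsurj
    have hinj : Function.Injective fun y : ZMod p => y ^ 3 :=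
      Finite.injective_iff_surjective.mpr hsurj
    have hr1 : r = 1 := hinj (by simp only; linear_combination (r - 1) * hr)
    apply hpN
    have h3 : ((3 : ℤ) : ZMod p) = 0 := by
      push_cast
      linear_combination hr - (r + 2) * hr1
    exact ((ZMod.intCast_zmod_eq_zero_iff_dvd 3 p).mp h3).mul_right _

/-- If every prime divisor of `M` is a cube modulo `p`, so is every divisor of a power of `M`. -/
theorem exists_pow_three_eq_of_dvd_pow {p M : ℕ}
    (h : ∀ q : ℕ, q.Prime → q ∣ M → ∃ y : ZMod p, y ^ 3 = q) {j : ℕ} {a : ℤ}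
    (ha : a ∣ (M : ℤ) ^ j) : ∃ y : ZMod p, y ^ 3 = a := by
  have key (n : ℕ) (hn : n ∣ M ^ j) (hn0 : n ≠ 0) : ∃ y : ZMod p, y ^ 3 = n := by
    induction n using Nat.recOnMul with
    | zero => exact absurd rfl hn0
    | one => exact ⟨1, by simp⟩
    | prime q hq => exact h q hq (hq.dvd_of_dvd_pow hn)
    | mul m n hm hn' =>
      obtain ⟨y, hy⟩ := hm (dvd_of_mul_right_dvd hn) (left_ne_zero_of_mul hn0)
      obtain ⟨z, hz⟩ := hn' (dvd_of_mul_left_dvd hn) (right_ne_zero_of_mul hn0)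
      exact ⟨y * z, by rw [mul_pow, hy, hz, Nat.cast_mul]⟩
  by_cases ha0 : a = 0
  · exact ⟨0, by simp [ha0]⟩
  obtain ⟨y, hy⟩ := key a.natAbs
    (by rw [← Int.natCast_dvd_natCast, Int.natAbs_dvd]; exact_mod_cast ha) (by simpa using ha0)
  rcases Int.natAbs_eq a with h | h
  · exact ⟨y, by rw [hy, h]; simp⟩
  · exact ⟨-y, by rw [h, Int.cast_neg, Int.cast_natCast, ← hy]; ring⟩

/-- The norm of an element congruent to the integer `c` modulo `p` is congruent to a power of `c`. -/
theorem Algebra.norm_natCast_mul_add_intCast {A : Type*} [CommRing A] [Module.Free ℤ A]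
    [Module.Finite ℤ A] (p : ℕ) (y : A) (c : ℤ) :
    ((Algebra.norm ℤ ((p : A) * y + (c : A)) : ℤ) : ZMod p) =
      (c : ZMod p) ^ Module.finrank ℤ A := by
  classical
  let β := Module.Free.chooseBasis ℤ A
  have hm : (Algebra.leftMulMatrix β ((p : A) * y + (c : A))).map (Int.castRingHom (ZMod p)) =
      Matrix.diagonal fun _ => (c : ZMod p) := by
    have h1 : (p : A) * y + (c : A) = (p : ℤ) • y + c • (1 : A) := by simp
    rw [h1, map_add, map_smul, map_smul, map_one]
    ext i j
    by_cases hij : i = j <;>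
      simp [-zsmul_eq_mul, -natCast_zsmul, -zsmul_one, Matrix.smul_apply, hij]
  rw [Algebra.norm_eq_matrix_det β, ← eq_intCast (Int.castRingHom (ZMod p)), RingHom.map_det,
    RingHom.mapMatrix_apply, hm, Matrix.det_diagonal, Finset.prod_const, Finset.card_univ,
    Module.finrank_eq_card_chooseBasisIndex]

/-- An `S`-integer becomes integral after multiplication by a power of an element lying in all
primes of `S`. -/
theorem Set.exists_pow_mul_eq_algebraMap_of_mem_integer {R K : Type*} [CommRing R]
    [IsDedekindDomain R] [Field K] [Algebra R K] [IsFractionRing R K]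
    {S : Set (HeightOneSpectrum R)} (hS : S.Finite) {m : R} (hm : ∀ v ∈ S, m ∈ v.asIdeal)
    {x : K} (hx : x ∈ S.integer K) :
    ∃ k₀ : ℕ, ∀ k ≥ k₀, ∃ y : R, algebraMap R K m ^ k * x = algebraMap R K y := by
  have hloc (v) (hv : v ∈ S) : ∃ k : ℕ, v.valuation K (algebraMap R K m ^ k * x) ≤ 1 := by
    by_cases hx0 : x = 0
    · exact ⟨0, by simp [hx0]⟩
    have hx0' : v.valuation K x ≠ 0 := (Valuation.ne_zero_iff _).mpr hx0
    obtain ⟨k, hk⟩ := exists_pow_lt₀ ((v.valuation_lt_one_iff_mem (K := K) m).mpr (hm v hv))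
      (Units.mk0 _ (inv_ne_zero hx0'))
    refine ⟨k, ?_⟩
    rw [map_mul, map_pow]
    calc _ ≤ (v.valuation K x)⁻¹ * v.valuation K x := by gcongr; exact hk.le
      _ = 1 := inv_mul_cancel₀ hx0'
  choose! κ hκ using hloc
  refine ⟨∑ v ∈ hS.toFinset, κ v, fun k hk => ?_⟩
  obtain ⟨y, hy⟩ := HeightOneSpectrum.mem_integers_of_valuation_le_one K
    (algebraMap R K m ^ k * x) (R := R) fun v => by
      by_cases hv : v ∈ S
      · have hle : κ v ≤ k := (Finset.single_le_sum (fun _ _ => Nat.zero_le _)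
          (hS.mem_toFinset.mpr hv)).trans hk
        rw [← Nat.sub_add_cancel hle, pow_add, mul_assoc, map_mul, map_pow]
        exact mul_le_one' (pow_le_one' (v.valuation_le_one m) _) (hκ v hv)
      · rw [map_mul, map_pow]
        exact mul_le_one' (pow_le_one' (v.valuation_le_one m) _) (hx v hv)
  exact ⟨y, hy.symm⟩

/-- for an imaginary quadratic `K` and a finite nonempty set `S` of finite places,
there are a rational prime `p` and `0 < b < p` such that `p·x + b` is never a unit of the ring
`O_{K,S}` of `S`-integers. -/
theorem exists_prime_and_b_not_unit {K : Type*} [Field K] [NumberField K]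
    (hdeg : Module.finrank ℚ K = 2) (himg : IsEmpty (K →+* ℝ))
    (S : Set (HeightOneSpectrum (𝓞 K))) (hSfin : S.Finite) (hSne : S.Nonempty) :
    ∃ (p b : ℕ), p.Prime ∧ 0 < b ∧ b < p ∧
      ∀ x : S.integer K, ¬ IsUnit ((p : S.integer K) * x + (b : S.integer K)) := by
  -- choose `M` in every prime of `S` and `p` such that divisors of powers of `M` are cubes mod `p`
  obtain ⟨M, hM0, hM⟩ : ∃ M : ℕ, M ≠ 0 ∧ ∀ v ∈ S, (M : 𝓞 K) ∈ v.asIdeal := by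
    refine ⟨∏ v ∈ hSfin.toFinset, Ideal.absNorm v.asIdeal,
      Finset.prod_ne_zero_iff.mpr fun v _ => Ideal.absNorm_eq_zero_iff.not.mpr v.ne_bot, ?_⟩
    intro v hv
    exact Ideal.mem_of_dvd _ (Nat.cast_dvd_cast (Finset.dvd_prod_of_mem
      (fun v : HeightOneSpectrum (𝓞 K) => Ideal.absNorm v.asIdeal) (hSfin.mem_toFinset.mpr hv)))
      (Ideal.absNorm_mem v.asIdeal)
  obtain ⟨p, hp, hpM, hcube, b, hb⟩ := exists_prime_cubes_zmod M hM0
  have := Fact.mk hp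
  have hb0 : b ≠ 0 := fun h => hb 0 (by simp [h])
  refine ⟨p, b.val, hp, Nat.pos_of_ne_zero ((ZMod.val_ne_zero b).mpr hb0), b.val_lt, ?_⟩
  rintro x ⟨u, hu⟩
  have huK : ((u : S.integer K) : K) = p * (x : K) + b.val := by
    rw [hu]
    push_cast
    rfl
  have hinvK : ((u : S.integer K) : K) * ((u⁻¹ : (S.integer K)ˣ) : S.integer K) = 1 := by
    exact_mod_cast congrArg (Subtype.val) u.mul_inv
  obtain ⟨k, hk⟩ := Set.exists_pow_mul_eq_algebraMap_of_mem_integer hSfin hM x.2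
  obtain ⟨l, hl⟩ := Set.exists_pow_mul_eq_algebraMap_of_mem_integer hSfin hM
    ((u⁻¹ : (S.integer K)ˣ) : S.integer K).2
  obtain ⟨y, hy⟩ := hk k le_rfl
  obtain ⟨z, hz⟩ := hl l le_rfl
  set w : 𝓞 K := p * y + ((M ^ k * b.val : ℕ) : ℤ) with hw
  have hwz : w * z = ((M : ℤ) ^ (k + l) : ℤ) := by
    apply FaithfulSMul.algebraMap_injective (𝓞 K) K
    rw [map_mul, ← hz, hw]
    simp only [map_add, map_mul, map_natCast, map_intCast, ← hy]
    push_cast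
    linear_combination (M : K) ^ (k + l) * hinvK -
      (M : K) ^ (k + l) * ((u⁻¹ : (S.integer K)ˣ) : S.integer K) * huK
  have hrank : Module.finrank ℤ (𝓞 K) = 2 := by rw [RingOfIntegers.rank, hdeg]
  have hdvd : Algebra.norm ℤ w ∣ (M : ℤ) ^ ((k + l) * 2) := by
    refine ⟨Algebra.norm ℤ z, ?_⟩
    rw [← map_mul, hwz, ← eq_intCast (algebraMap ℤ (𝓞 K)), Algebra.norm_algebraMap, hrank, pow_mul]
  obtain ⟨s, hs⟩ := exists_pow_three_eq_of_dvd_pow hcube hdvd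
  rw [hw, Algebra.norm_natCast_mul_add_intCast, hrank] at hs
  obtain ⟨t, ht⟩ := exists_pow_three_eq_of_dvd_pow hcube (dvd_refl ((M : ℤ) ^ k))
  have hMp : (M : ZMod p) ≠ 0 := fun h => hpM ((ZMod.natCast_eq_zero_iff M p).mp h)
  have ht0 : t ≠ 0 := by
    rintro rfl
    exact pow_ne_zero k hMp (by simpa using ht.symm)
  push_cast [ZMod.natCast_zmod_val] at hs ht
  -- `b ^ 2` is a cube modulo `p`, hence so is `b = b ^ 3 / b ^ 2`
  have hs' : s ^ 3 = (t ^ 2) ^ 3 * b ^ 2 := by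
    rw [hs, ← ht]; ring
  have hs0 : s ≠ 0 := by
    rintro rfl
    exact mul_ne_zero (pow_ne_zero 3 (pow_ne_zero 2 ht0)) (pow_ne_zero 2 hb0)
      (by simpa using hs'.symm)
  refine hb (b * t ^ 2 / s) ?_
  rw [div_pow, div_eq_iff (pow_ne_zero 3 hs0), hs']
  ring
end

section
/- Let K be an imaginary quadratic field and S a finite nonempty set of finite places. For every nonzero x ∈ O_{K,S} there exists a unit ε ∈ O_{K,S}^× of infinite order such that x divides ε − 1 in O_{K,S}. -/
open IsDedekindDomain NumberField

/-- In a Dedekind domain with finite class group, every maximal ideal `v` contains an element that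
avoids all the other ones: a generator of a principal power of `v`. -/
theorem exists_mem_iff_eq_heightOneSpectrum {R : Type*} [CommRing R] [IsDedekindDomain R]
    [Finite (ClassGroup R)] (v : HeightOneSpectrum R) :
    ∃ p : R, p ≠ 0 ∧ ∀ w : HeightOneSpectrum R, p ∈ w.asIdeal ↔ w = v := by
  have hcard : Nat.card (ClassGroup R) ≠ 0 := Nat.card_pos.ne'
  let I : nonZeroDivisors (Ideal R) := ⟨v.asIdeal, mem_nonZeroDivisors_of_ne_zero v.ne_bot⟩
  have hprin : (v.asIdeal ^ Nat.card (ClassGroup R)).IsPrincipal := by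
    have h : ClassGroup.mk0 (I ^ Nat.card (ClassGroup R)) = 1 := by
      rw [map_pow, pow_card_eq_one']
    exact (ClassGroup.mk0_eq_one_iff (I ^ Nat.card (ClassGroup R)).2).1 h
  obtain ⟨p, hp⟩ := hprin.principal
  replace hp : v.asIdeal ^ Nat.card (ClassGroup R) = Ideal.span {p} := hp
  refine ⟨p, ?_, fun w => ?_⟩
  · rintro rfl
    rw [Ideal.span_singleton_zero] at hp
    exact pow_ne_zero _ v.ne_bot hp
  · rw [← Ideal.span_singleton_le_iff_mem, ← hp, w.isPrime.pow_le_iff hcard]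
    constructor
    · intro h
      exact HeightOneSpectrum.ext (v.isMaximal.eq_of_le w.isPrime.ne_top h).symm
    · rintro rfl
      exact le_rfl

/-- If `R ⧸ (a)` is finite, then `a` divides `p ^ i * (p ^ k - 1)` for some `i` and some `k ≠ 0`. -/
theorem exists_dvd_pow_mul_pow_sub_one {R : Type*} [CommRing R] (a p : R)
    [Finite (R ⧸ Ideal.span {a})] : ∃ i k : ℕ, k ≠ 0 ∧ a ∣ p ^ i * (p ^ k - 1) := by
  obtain ⟨i, j, hij, h⟩ := Finite.exists_ne_map_eq_of_infinite
    fun n : ℕ => Ideal.Quotient.mk (Ideal.span {a}) (p ^ n)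
  wlog hlt : i < j generalizing i j
  · exact this j i hij.symm h.symm (by lia)
  obtain ⟨k, rfl⟩ := Nat.exists_eq_add_of_lt hlt
  refine ⟨i, k + 1, k.succ_ne_zero, ?_⟩
  rw [← Ideal.mem_span_singleton]
  convert Ideal.Quotient.eq.1 h.symm using 1
  ring

/-- for every nonzero `x ∈ O_{K,S}` (with `S` finite and nonempty) there is an
`S`-unit `ε` of infinite order with `x ∣ ε − 1` in `O_{K,S}`. -/
theorem exists_infinite_order_unit_dvd {K : Type*} [Field K] [NumberField K]
    (hdeg : Module.finrank ℚ K = 2) (himg : IsEmpty (K →+* ℝ))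
    (S : Set (HeightOneSpectrum (𝓞 K))) (hSfin : S.Finite) (hSne : S.Nonempty)
    (x : S.integer K) (hx : x ≠ 0) :
    ∃ ε : (S.integer K)ˣ, (∀ n : ℕ, 1 ≤ n → ε ^ n ≠ 1) ∧
      x ∣ ((ε : S.integer K) - 1) := by
  obtain ⟨v, hv⟩ := hSne
  obtain ⟨p, hp0, hp⟩ := exists_mem_iff_eq_heightOneSpectrum v
  have hpK : algebraMap (𝓞 K) K p ≠ 0 := by simpa using hp0
  have hpS : Units.mk0 _ hpK ∈ S.unit K := by
    intro w hw
    have hpw : p ∉ w.asIdeal := fun h => hw ((hp w).1 h ▸ hv)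
    exact (w.valuation_le_one p).antisymm
      (not_lt.1 fun h => hpw ((w.valuation_lt_one_iff_mem p).1 h))
  let u : (S.integer K)ˣ := S.unitEquivUnitsInteger K ⟨_, hpS⟩
  have hu : (u : S.integer K) = algebraMap (𝓞 K) (S.integer K) p := rfl
  have hu_order (n : ℕ) (hn : n ≠ 0) : u ^ n ≠ 1 := by
    intro h
    have hone : p ^ n = 1 := by
      apply FaithfulSMul.algebraMap_injective (𝓞 K) (S.integer K)
      rw [map_pow, ← hu, map_one, ← Units.val_pow_eq_pow_val, h, Units.val_one]
    refine v.isPrime.ne_top ((Ideal.eq_top_iff_one _).2 ?_)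
    rw [← hone]
    exact Ideal.pow_mem_of_mem _ ((hp v).2 rfl) n (Nat.pos_of_ne_zero hn)
  obtain ⟨a, b, hb, hab⟩ := IsFractionRing.div_surjective (A := 𝓞 K) (x : K)
  have hbK : algebraMap (𝓞 K) K b ≠ 0 := by simpa using nonZeroDivisors.ne_zero hb
  have ha0 : a ≠ 0 := by
    rintro rfl
    exact hx (Subtype.ext (by simpa using hab.symm))
  have hxa : x ∣ algebraMap (𝓞 K) (S.integer K) a := by
    refine ⟨algebraMap (𝓞 K) (S.integer K) b, Subtype.ext ?_⟩
    exact (div_eq_iff hbK).1 hab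
  have : Finite (𝓞 K ⧸ Ideal.span {a}) := Ideal.finiteQuotientOfFreeOfNeBot _ (by simpa using ha0)
  obtain ⟨i, k, hk, hdvd⟩ := exists_dvd_pow_mul_pow_sub_one a p
  refine ⟨u ^ k, fun n hn => ?_, ?_⟩
  · rw [← pow_mul]
    exact hu_order _ (mul_ne_zero hk (by lia))
  · have h := hxa.trans (map_dvd (algebraMap (𝓞 K) (S.integer K)) hdvd)
    rw [map_mul, map_sub, map_pow, map_pow, map_one, ← hu, ← Units.val_pow_eq_pow_val,
      Units.dvd_mul_left] at h
    simpa using h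
end

section
/- Let K be an imaginary quadratic field and S a finite nonempty set of finite places. The set Prod_u = {(x,y,z) ∈ (O_{K,S}^×)³ : z = x·y} of unit triples closed under multiplication is positive-existentially definable in the structure (O_{K,S}; 0, 1, +, ∣). -/
open FirstOrder IsDedekindDomain NumberField

/-- Function symbols of the divisibility language: constants `0`, `1` and binary `+`. -/
def DivFun : ℕ → Type
  | 0 => Fin 2
  | 2 => Unit
  | _ => Empty

/-- Relation symbols: a single binary relation `∣`. -/
def DivRel : ℕ → Type
  | 2 => Unit
  | _ => Empty

/-- The language `{=, 0, 1, +, ∣}`. -/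
def DivLang : Language := ⟨DivFun, DivRel⟩

/-- Any commutative ring is a structure for `DivLang`, interpreting `0`, `1`, `+` and
divisibility. -/
instance divStructure (R : Type*) [CommRing R] : DivLang.Structure R where
  funMap {n} f x :=
    match n, f, x with
    | 0, f, _ => if (show Fin 2 from f) = 0 then 0 else 1
    | 2, _, x => x 0 + x 1
  RelMap {n} r x :=
    match n, r, x with
    | 2, _, x => x 0 ∣ x 1

/-- Positive-existential bounded formulas: built from atomic formulas by `∧`, `∨` and `∃`. -/
inductive PosEx {α : Type} : {n : ℕ} → DivLang.BoundedFormula α n → Prop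
  | equal {n} (t u : DivLang.Term (α ⊕ Fin n)) : PosEx (t.bdEqual u)
  | rel {n l} (R : DivLang.Relations l) (ts : Fin l → DivLang.Term (α ⊕ Fin n)) :
      PosEx (FirstOrder.Language.BoundedFormula.rel R ts)
  | inf {n} {φ ψ : DivLang.BoundedFormula α n} : PosEx φ → PosEx ψ → PosEx (φ ⊓ ψ)
  | sup {n} {φ ψ : DivLang.BoundedFormula α n} : PosEx φ → PosEx ψ → PosEx (φ ⊔ ψ)
  | ex {n} {φ : DivLang.BoundedFormula α (n + 1)} : PosEx φ → PosEx φ.ex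

section AbsoluteValues

variable {R ι : Type*} [CommRing R] [Fintype ι] (f : ι → AbsoluteValue R ℝ)

/-- The product of finitely many absolute values. -/
def prodAbs (x : R) : ℝ := ∏ i, f i x

/-- The height of `x` with respect to finitely many absolute values. -/
noncomputable def prodMax (x : R) : ℝ := ∏ i, max 1 (f i x)

lemma prodAbs_mul (x y : R) : prodAbs f (x * y) = prodAbs f x * prodAbs f y := by
  simp [prodAbs, Finset.prod_mul_distrib]

lemma prodAbs_nonneg (x : R) : 0 ≤ prodAbs f x :=
  Finset.prod_nonneg fun i _ => (f i).nonneg x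

lemma prodAbs_prod [IsDomain R] {α : Type*} (s : Finset α) (g : α → R) :
    prodAbs f (∏ a ∈ s, g a) = ∏ a ∈ s, prodAbs f (g a) := by
  classical
  induction s using Finset.induction_on with
  | empty => simp [prodAbs]
  | insert a s ha ih => rw [Finset.prod_insert ha, Finset.prod_insert ha, prodAbs_mul, ih]

lemma one_le_prodMax (x : R) : 1 ≤ prodMax f x :=
  Finset.one_le_prod fun _ _ => le_max_left _ _

lemma apply_le_prodMax (i : ι) (x : R) : f i x ≤ prodMax f x := by
  classical
  rw [prodMax, ← Finset.mul_prod_erase _ _ (Finset.mem_univ i)]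
  have h : 1 ≤ ∏ j ∈ Finset.univ.erase i, max 1 (f j x) :=
    Finset.one_le_prod fun _ _ => le_max_left _ _
  have h0 : 0 ≤ max 1 (f i x) := by positivity
  nlinarith [le_max_right 1 (f i x)]

lemma prodAbs_sub_mul_le (x y z : R) :
    prodAbs f (z - x * y) ≤
      2 ^ Fintype.card ι * (prodMax f x * prodMax f y * prodMax f z) := by
  simp only [prodAbs, prodMax, ← Finset.prod_mul_distrib]
  rw [← Finset.card_univ, ← Finset.prod_const, ← Finset.prod_mul_distrib]
  refine Finset.prod_le_prod (fun i _ => (f i).nonneg _) fun i _ => ?_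
  have h1 : f i (z - x * y) ≤ f i z + f i x * f i y := by
    simpa [sub_eq_add_neg] using (f i).add_le z (-(x * y))
  have hx := le_max_left 1 (f i x)
  have hx' := le_max_right 1 (f i x)
  have hy := le_max_left 1 (f i y)
  have hy' := le_max_right 1 (f i y)
  have hz := le_max_left 1 (f i z)
  have hz' := le_max_right 1 (f i z)
  have hxy : f i x * f i y ≤ max 1 (f i x) * max 1 (f i y) :=
    mul_le_mul hx' hy' ((f i).nonneg _) (by positivity)
  have hxy1 : 1 ≤ max 1 (f i x) * max 1 (f i y) := one_le_mul_of_one_le_of_one_le hx hy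
  nlinarith

/-- If the absolute values of differences of elements of `A` are bounded below, then `x + a` is
bounded below at all the absolute values for all but `card ι` elements `a` of `A`. -/
lemma exists_subset_forall_le_apply_add {δ : ℝ} {A : Finset ℕ} {k : ℕ}
    (hA : Fintype.card ι + k ≤ A.card)
    (hδ : ∀ i, ∀ a ∈ A, ∀ b ∈ A, a ≠ b → 2 * δ ≤ f i ((a : R) - b)) (x : R) :
    ∃ B ⊆ A, B.card = k ∧ ∀ a ∈ B, ∀ i, δ ≤ f i (x + a) := by
  classical
  have hbad : ∀ i, (A.filter fun a : ℕ => f i (x + a) < δ).card ≤ 1 := by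
    refine fun i => Finset.card_le_one.2 fun a ha b hb => ?_
    by_contra hab
    rw [Finset.mem_filter] at ha hb
    have h1 := hδ i a ha.1 b hb.1 hab
    have h2 : f i ((a : R) - b) ≤ f i (x + a) + f i (x + b) := by
      have := (f i).add_le (x + a) (-(x + b))
      rw [(f i).map_neg] at this
      rwa [neg_add, add_add_add_comm, add_neg_cancel, zero_add, ← sub_eq_add_neg] at this
    linarith
  let U := Finset.univ.biUnion fun i => A.filter fun a : ℕ => f i (x + a) < δ
  have hU : U.card ≤ Fintype.card ι := by
    simpa using Finset.card_biUnion_le_card_mul Finset.univ _ 1 fun i _ => hbad i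
  have hcard : k ≤ (A \ U).card := by
    have := Finset.le_card_sdiff U A
    omega
  obtain ⟨B, hB, hBk⟩ := Finset.exists_subset_card_eq hcard
  refine ⟨B, hB.trans Finset.sdiff_subset, hBk, fun a ha i => ?_⟩
  have ha' := Finset.mem_sdiff.1 (hB ha)
  by_contra h
  exact ha'.2 (Finset.mem_biUnion.2 ⟨i, Finset.mem_univ i,
    Finset.mem_filter.2 ⟨ha'.1, not_le.1 h⟩⟩)

lemma exists_pos_le_apply_sub [CharZero R] (A : Finset ℕ) :
    ∃ δ : ℝ, 0 < δ ∧ δ ≤ 1 ∧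
      ∀ i, ∀ a ∈ A, ∀ b ∈ A, a ≠ b → 2 * δ ≤ f i ((a : R) - b) := by
  classical
  have hpos : ∀ i, ∀ a ∈ A, ∀ b ∈ A, a ≠ b → 0 < f i ((a : R) - b) := fun i a _ b _ hab =>
    (f i).pos (sub_ne_zero.2 (Nat.cast_injective.ne hab))
  let T : Finset ℝ := insert 2 ((Finset.univ ×ˢ A.offDiag).image
    fun p : ι × ℕ × ℕ => f p.1 ((p.2.1 : R) - p.2.2))
  have hT : T.Nonempty := Finset.insert_nonempty _ _
  refine ⟨T.min' hT / 2, ?_, ?_, fun i a ha b hb hab => ?_⟩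
  · suffices 0 < T.min' hT by linarith
    rw [Finset.lt_min'_iff]
    intro y hy
    rcases Finset.mem_insert.1 hy with rfl | hy
    · norm_num
    · obtain ⟨p, hp, rfl⟩ := Finset.mem_image.1 hy
      obtain ⟨h1, h2, h3⟩ := Finset.mem_offDiag.1 (Finset.mem_product.1 hp).2
      exact hpos _ _ h1 _ h2 h3
  · have := T.min'_le 2 (Finset.mem_insert_self _ _)
    linarith
  · have : T.min' hT ≤ f i ((a : R) - b) := T.min'_le _ (Finset.mem_insert_of_mem
      (Finset.mem_image.2 ⟨(i, a, b), by simp [ha, hb, hab], rfl⟩))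
    linarith

/-- If all `x + a` with `a ∈ B` divide `β`, then so does their product, up to a constant which
depends only on `B`. -/
lemma exists_prod_add_dvd_mul [IsDomain R] [CharZero R] (B : Finset ℕ) :
    ∃ c : R, c ≠ 0 ∧ ∀ x β : R, (∀ a ∈ B, x + a ∣ β) → ∏ a ∈ B, (x + a) ∣ c * β := by
  classical
  induction B using Finset.induction_on with
  | empty => exact ⟨1, one_ne_zero, by simp⟩
  | insert b B hb ih =>
    obtain ⟨c, hc, h⟩ := ih
    refine ⟨(∏ a ∈ B, ((a : R) - b)) * c, mul_ne_zero (Finset.prod_ne_zero_iff.2 ?_) hc, ?_⟩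
    · rintro a ha
      exact sub_ne_zero.2 (Nat.cast_injective.ne fun hab => hb (hab ▸ ha))
    intro x β hβ
    have h1 := h x β fun a ha => hβ a (Finset.mem_insert_of_mem ha)
    have h2 : x + b ∣ c * β := (hβ b (Finset.mem_insert_self _ _)).mul_left _
    have h3 : x + b ∣ ∏ a ∈ B, (x + a) - ∏ a ∈ B, ((a : R) - b) := by
      let q : Polynomial R := ∏ a ∈ B, (Polynomial.X + Polynomial.C (a : R))
      have := q.sub_dvd_eval_sub x (-b)
      simpa [q, Polynomial.eval_prod, neg_add_eq_sub] using this
    rw [Finset.prod_insert hb, mul_assoc]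
    obtain ⟨u, hu⟩ := h3
    have h4 : (∏ a ∈ B, ((a : R) - b)) = ∏ a ∈ B, (x + a) - (x + b) * u := by
      rw [← hu]; ring
    rw [h4, sub_mul]
    refine dvd_sub ?_ ?_
    · rw [mul_comm]
      exact mul_dvd_mul_left _ h2
    · rw [mul_assoc]
      exact mul_dvd_mul_left _ (h1.mul_left _)

variable {f}

lemma prodAbs_le_of_dvd (hf : ∀ r : R, r ≠ 0 → 1 ≤ prodAbs f r) {x y : R} (h : x ∣ y)
    (hy : y ≠ 0) : prodAbs f x ≤ prodAbs f y := by
  obtain ⟨z, rfl⟩ := h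
  rw [prodAbs_mul]
  exact le_mul_of_one_le_right (prodAbs_nonneg f x) (hf z (right_ne_zero_of_mul hy))

variable (f) in
lemma exists_pos_mul_prodMax_le [IsDomain R] (A : Finset ℕ) {δ : ℝ} (hδ : 0 < δ)
    (hδ1 : δ ≤ 1) :
    ∃ ε : ℝ, 0 < ε ∧ ∀ x : R, ∀ a ∈ A, (∀ i, δ ≤ f i (x + a)) →
      ε * prodMax f x ≤ prodAbs f (x + a) := by
  obtain ⟨M, hM⟩ : ∃ M : ℕ, ∀ a ∈ A, a ≤ M := ⟨A.sup id, fun a ha => Finset.le_sup (f := id) ha⟩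
  have hM0 : (0 : ℝ) < 2 * (M + 1) := by positivity
  refine ⟨(δ / (2 * (M + 1))) ^ Fintype.card ι, by positivity, fun x a ha h => ?_⟩
  rw [prodMax, prodAbs, ← Finset.card_univ, ← Finset.prod_const, ← Finset.prod_mul_distrib]
  refine Finset.prod_le_prod (fun i _ => by positivity) fun i _ => ?_
  rw [div_mul_eq_mul_div, div_le_iff₀ hM0]
  have haM : f i (a : R) ≤ M := by
    have : f i (a : R) ≤ a := by
      clear ha h
      induction a with
      | zero => simp
      | succ n ih =>
        have := (f i).add_le (n : R) 1
        rw [(f i).map_one] at this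
        push_cast
        linarith
    exact this.trans (by exact_mod_cast hM a ha)
  have hx : f i x ≤ f i (x + a) + f i (a : R) := by
    simpa using (f i).add_le (x + a) (-a)
  have hM' : (0 : ℝ) ≤ M := by positivity
  rcases le_total (2 * ((M : ℝ) + 1)) (f i x) with h2 | h2
  · rw [max_eq_right (by linarith)]
    nlinarith
  · have h3 : max 1 (f i x) ≤ 2 * (M + 1) := max_le (by linarith) h2
    exact mul_le_mul (h i) h3 (by positivity) ((f i).nonneg _)

/-- An element divisible by sufficiently many translates `x + a` has large norm. -/
lemma exists_prodMax_pow_le [IsDomain R] [CharZero R]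
    (hf : ∀ r : R, r ≠ 0 → 1 ≤ prodAbs f r) (k : ℕ) :
    ∃ (A : Finset ℕ) (c : ℝ), 0 < c ∧ ∀ x β : R, β ≠ 0 → (∀ a ∈ A, x + a ∣ β) →
      prodMax f x ^ k ≤ c * prodAbs f β := by
  set A := Finset.range (Fintype.card ι + k)
  obtain ⟨δ, hδ, hδ1, hδA⟩ := exists_pos_le_apply_sub f A
  obtain ⟨ε, hε, hεA⟩ := exists_pos_mul_prodMax_le f A hδ hδ1
  choose c hc0 hc using exists_prod_add_dvd_mul (R := R)
  refine ⟨A, (∑ B ∈ A.powerset, prodAbs f (c B)) / ε ^ k, ?_, fun x β hβ h => ?_⟩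
  · refine div_pos (Finset.sum_pos (fun B _ => ?_) ⟨∅, by simp⟩) (by positivity)
    exact zero_lt_one.trans_le (hf _ (hc0 B))
  obtain ⟨B, hBA, hBk, hB⟩ := exists_subset_forall_le_apply_add f (by simp [A]) hδA x (k := k)
  have h1 := prodAbs_le_of_dvd hf (hc B x β fun a ha => h a (hBA ha)) (mul_ne_zero (hc0 B) hβ)
  rw [prodAbs_mul, prodAbs_prod] at h1
  have h2 : (ε * prodMax f x) ^ k ≤ ∏ a ∈ B, prodAbs f (x + a) := by
    rw [← hBk, ← Finset.prod_const]
    have := one_le_prodMax f x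
    exact Finset.prod_le_prod (fun _ _ => by positivity) fun a ha => hεA x a (hBA ha) (hB a ha)
  have h3 : prodAbs f (c B) ≤ ∑ B ∈ A.powerset, prodAbs f (c B) :=
    Finset.single_le_sum (f := fun B => prodAbs f (c B)) (fun B _ => prodAbs_nonneg f _)
      (Finset.mem_powerset.2 hBA)
  rw [div_mul_eq_mul_div, le_div_iff₀ (by positivity), mul_comm, ← mul_pow]
  exact (h2.trans h1).trans (mul_le_mul_of_nonneg_right h3 (prodAbs_nonneg f β))

variable (f) in
/-- Elements of bounded height have translates of large norm. -/
lemma exists_lt_prodAbs_add [CharZero R] {i₀ : ι} (hi₀ : ∀ n : ℕ, f i₀ (n : R) = n) (C T : ℝ) :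
    ∃ A : Finset ℕ, ∀ x : R, prodMax f x ≤ C → ∃ a ∈ A, T < prodAbs f (x + a) := by
  classical
  obtain ⟨δ, hδ, hδ1, hδA⟩ := exists_pos_le_apply_sub f (Finset.range (Fintype.card ι + 1))
  have hδn : 0 < δ ^ (Fintype.card ι - 1) := by positivity
  obtain ⟨L, hL⟩ := exists_nat_gt (C + T / δ ^ (Fintype.card ι - 1))
  refine ⟨(Finset.range (Fintype.card ι + 1)).image (L + ·), fun x hx => ?_⟩
  obtain ⟨B, hBA, hB1, hB⟩ := exists_subset_forall_le_apply_add f (by simp) hδA (x + L) (k := 1)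
  obtain ⟨a, rfl⟩ := Finset.card_eq_one.1 hB1
  have ha := hB a (Finset.mem_singleton_self a)
  refine ⟨L + a, Finset.mem_image_of_mem _ (hBA (Finset.mem_singleton_self a)), ?_⟩
  rw [Nat.cast_add, ← add_assoc, prodAbs, ← Finset.mul_prod_erase _ _ (Finset.mem_univ i₀)]
  have h1 : δ ^ (Fintype.card ι - 1) ≤ ∏ i ∈ Finset.univ.erase i₀, f i (x + L + a) := by
    rw [← Finset.card_univ, ← Finset.card_erase_of_mem (Finset.mem_univ i₀), ← Finset.prod_const]
    exact Finset.prod_le_prod (fun _ _ => hδ.le) fun i _ => ha i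
  have h2 : (L : ℝ) - C ≤ f i₀ (x + L + a) := by
    have h3 := (f i₀).add_le (x + L + a) (-x)
    have h4 : x + L + a + -x = ((L + a : ℕ) : R) := by push_cast; ring
    rw [h4, hi₀, (f i₀).map_neg] at h3
    have h5 := (apply_le_prodMax f i₀ x).trans hx
    push_cast at h3
    have : (0 : ℝ) ≤ a := by positivity
    linarith
  have h3 : T < (L - C) * δ ^ (Fintype.card ι - 1) := by
    rw [← div_lt_iff₀ hδn]; linarith
  refine h3.trans_le (mul_le_mul h2 h1 hδn.le ((f i₀).nonneg _))

/-- A finite set of translates for which divisibility forces an element of small norm to vanish. -/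
lemma exists_finset_forall_dvd_eq_zero [IsDomain R] [CharZero R]
    (hf : ∀ r : R, r ≠ 0 → 1 ≤ prodAbs f r) {i₀ : ι} (hi₀ : ∀ n : ℕ, f i₀ (n : R) = n) :
    ∃ A : Finset ℕ, ∀ x y z β : R,
      prodAbs f β ≤ 2 ^ Fintype.card ι * (prodMax f x * prodMax f y * prodMax f z) →
      (∀ a ∈ A, x + a ∣ β) → (∀ a ∈ A, y + a ∣ β) → (∀ a ∈ A, z + a ∣ β) → β = 0 := by
  classical
  obtain ⟨A, c, hc, hA⟩ := exists_prodMax_pow_le hf 4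
  set D : ℝ := 2 ^ Fintype.card ι
  have hD0 : 0 < D := by positivity
  obtain ⟨A', hA'⟩ := exists_lt_prodAbs_add f hi₀ ((c * D) ^ 3) (D * (c * D) ^ 3)
  refine ⟨A ∪ A', fun x y z β hβ hx hy hz => ?_⟩
  by_contra h0
  have kx := hA x β h0 fun a ha => hx a (Finset.mem_union_left _ ha)
  have ky := hA y β h0 fun a ha => hy a (Finset.mem_union_left _ ha)
  have kz := hA z β h0 fun a ha => hz a (Finset.mem_union_left _ ha)
  have hx1 := one_le_prodMax f x
  have hy1 := one_le_prodMax f y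
  have hz1 := one_le_prodMax f z
  set P := prodMax f x * prodMax f y * prodMax f z with hP
  have hP1 : 1 ≤ P := one_le_mul_of_one_le_of_one_le (one_le_mul_of_one_le_of_one_le hx1 hy1) hz1
  have hN : c * prodAbs f β ≤ c * D * P := by
    rw [mul_assoc]; exact mul_le_mul_of_nonneg_left hβ hc.le
  have hcN : 0 ≤ c * prodAbs f β := mul_nonneg hc.le (prodAbs_nonneg f β)
  have hP4 : P ^ 4 ≤ (c * D) ^ 3 * P ^ 3 := by
    calc P ^ 4 = prodMax f x ^ 4 * prodMax f y ^ 4 * prodMax f z ^ 4 := by rw [hP]; ring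
      _ ≤ (c * prodAbs f β) * (c * prodAbs f β) * (c * prodAbs f β) := by gcongr
      _ = (c * prodAbs f β) ^ 3 := by ring
      _ ≤ (c * D * P) ^ 3 := by gcongr
      _ = _ := by ring
  have hPC : P ≤ (c * D) ^ 3 := by
    have : 0 < P ^ 3 := by positivity
    exact le_of_mul_le_mul_right (by linarith [pow_succ' P 3]) this
  have hxP : prodMax f x ≤ P := by
    rw [hP, mul_assoc]
    exact le_mul_of_one_le_right (by linarith) (one_le_mul_of_one_le_of_one_le hy1 hz1)
  obtain ⟨a, ha, hlt⟩ := hA' x (hxP.trans hPC)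
  have h1 := prodAbs_le_of_dvd hf (hx a (Finset.mem_union_right _ ha)) h0
  have h2 : D * P ≤ D * (c * D) ^ 3 := mul_le_mul_of_nonneg_left hPC hD0.le
  linarith

/-- The multiplication of units is described by finitely many divisibilities of linear forms. -/
lemma exists_finset_isUnit_mul_iff [IsDomain R] [CharZero R]
    (hf : ∀ r : R, r ≠ 0 → 1 ≤ prodAbs f r) {i₀ : ι} (hi₀ : ∀ n : ℕ, f i₀ (n : R) = n) :
    ∃ A : Finset ℕ, ∀ x y z : R,
      (∃ t : R, (x ∣ 1 ∧ y ∣ 1 ∧ z ∣ 1) ∧ ∀ a ∈ A,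
        (y + a ∣ 1 + a • t ∧ t + a ∣ 1 + a • y) ∧
        (x + a ∣ z + a • y ∧ y + a ∣ z + a • x) ∧ z + a ∣ x + a • t) ↔
      (IsUnit x ∧ IsUnit y ∧ IsUnit z ∧ z = x * y) := by
  obtain ⟨A, hA⟩ := exists_finset_forall_dvd_eq_zero hf hi₀
  have key : ∀ {u v w : R} {a : ℕ}, u + a ∣ w + a • v → u + a ∣ w - u * v := fun {u v w a} h => by
    have h1 : u + a ∣ (u + a) * v := dvd_mul_right _ _
    convert dvd_sub h h1 using 1
    simp only [nsmul_eq_mul]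
    ring
  refine ⟨A, fun x y z => ⟨?_, ?_⟩⟩
  · rintro ⟨t, ⟨hx, hy, hz⟩, h⟩
    have hyt : 1 - y * t = 0 := by
      refine hA y t t _ ((prodAbs_sub_mul_le f y t 1).trans ?_) (fun a ha => key (h a ha).1.1)
        (fun a ha => ?_) fun a ha => ?_
      · have h1 : prodMax f (1 : R) = 1 := by simp [prodMax]
        rw [h1]
        have hy1 := one_le_prodMax f y
        have ht1 := one_le_prodMax f t
        gcongr
      all_goals
        rw [mul_comm]
        exact key (h a ha).1.2
    have hzx : z - x * y = 0 := by
      refine hA x y z _ (prodAbs_sub_mul_le f x y z) (fun a ha => key (h a ha).2.1.1)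
        (fun a ha => ?_) fun a ha => ?_
      · rw [mul_comm]
        exact key (h a ha).2.1.2
      · convert (key (h a ha).2.2).mul_left (-y) using 1
        linear_combination z * hyt
    exact ⟨isUnit_of_dvd_one hx, isUnit_of_dvd_one hy, isUnit_of_dvd_one hz, sub_eq_zero.1 hzx⟩
  · rintro ⟨hx, hy, hz, rfl⟩
    obtain ⟨t, ht⟩ := hy.exists_right_inv
    refine ⟨t, ⟨hx.dvd, hy.dvd, hz.dvd⟩, fun a _ => ⟨⟨⟨t, ?_⟩, ⟨y, ?_⟩⟩, ⟨⟨y, ?_⟩, ⟨x, ?_⟩⟩, ⟨t, ?_⟩⟩⟩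
    all_goals simp only [nsmul_eq_mul]
    · linear_combination -ht
    · linear_combination -ht
    · ring
    · ring
    · linear_combination -x * ht

end AbsoluteValues

section NumberField

variable {K : Type*} [Field K] [NumberField K]

/-- The absolute values on the `S`-integers coming from the complex embeddings and from `S`. -/
noncomputable def integerAbs (S : Set (HeightOneSpectrum (𝓞 K))) :
    (K →ₐ[ℚ] ℂ) ⊕ S → AbsoluteValue (S.integer K) ℝ
  | .inl σ => (NormedField.toAbsoluteValue ℂ).comp
      (f := (σ : K →+* ℂ).comp (S.integer K).val.toRingHom)
      (σ.injective.comp Subtype.val_injective)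
  | .inr v => (NumberField.HeightOneSpectrum.adicAbv K v.1).comp
      (f := (S.integer K).val.toRingHom) Subtype.val_injective

lemma integerAbs_inl (S : Set (HeightOneSpectrum (𝓞 K))) (σ : K →ₐ[ℚ] ℂ) (x : S.integer K) :
    integerAbs S (.inl σ) x = ‖σ x‖ := rfl

lemma prod_norm_embeddings_mul_finprod_adicAbv {x : K} (hx : x ≠ 0) :
    (∏ σ : K →ₐ[ℚ] ℂ, ‖σ x‖) *
      ∏ᶠ v : HeightOneSpectrum (𝓞 K), NumberField.HeightOneSpectrum.adicAbv K v x = 1 := by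
  have h1 : ∏ σ : K →ₐ[ℚ] ℂ, ‖σ x‖ = |Algebra.norm ℚ x| := by
    rw [← norm_prod, ← Algebra.norm_eq_prod_embeddings ℚ ℂ x, eq_ratCast, Rat.cast_abs,
      ← Real.norm_eq_abs, ← Complex.norm_real, Complex.ofReal_ratCast]
  have h2 : ∏ᶠ v : HeightOneSpectrum (𝓞 K), NumberField.HeightOneSpectrum.adicAbv K v x =
      ∏ᶠ w : FinitePlace K, w x := by
    rw [← finprod_comp_equiv FinitePlace.equivHeightOneSpectrum.symm]
    refine finprod_congr fun v => ?_
    rw [FinitePlace.equivHeightOneSpectrum_symm_apply, FinitePlace.norm_embedding]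
  rw [h1, h2, FinitePlace.prod_eq_inv_abs_norm hx, Rat.cast_inv]
  refine mul_inv_cancel₀ ?_
  simpa using hx

lemma adicAbv_le_one_of_valuation_le_one {v : HeightOneSpectrum (𝓞 K)} {x : K}
    (h : v.valuation K x ≤ 1) : NumberField.HeightOneSpectrum.adicAbv K v x ≤ 1 := by
  rw [NumberField.HeightOneSpectrum.adicAbv_def]
  have := (WithZeroMulInt.toNNReal_strictMono
    (NumberField.HeightOneSpectrum.one_lt_absNorm_nnreal v)).monotone h
  rw [map_one] at this
  exact_mod_cast this

lemma one_le_prodAbs_integerAbs (S : Set (HeightOneSpectrum (𝓞 K))) [Fintype S]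
    (x : S.integer K) (hx : x ≠ 0) : 1 ≤ prodAbs (integerAbs S) x := by
  classical
  have hxK : (x : K) ≠ 0 := fun h => hx (Subtype.ext h)
  let g : HeightOneSpectrum (𝓞 K) → ℝ := fun v => NumberField.HeightOneSpectrum.adicAbv K v x
  have hsupp : g.HasFiniteMulSupport := by
    have h := FinitePlace.hasFiniteMulSupport hxK
    have h' : g = (fun w : FinitePlace K => w x) ∘ FinitePlace.equivHeightOneSpectrum.symm := by
      funext v
      rw [Function.comp_apply, FinitePlace.equivHeightOneSpectrum_symm_apply,
        FinitePlace.norm_embedding]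
    rw [h']
    exact h.comp_of_injective (Equiv.injective _)
  let T : Finset (HeightOneSpectrum (𝓞 K)) := Set.Finite.toFinset hsupp ∪ S.toFinset
  have hT : ∏ᶠ v, g v = ∏ v ∈ T, g v :=
    finprod_eq_prod_of_mulSupport_subset g fun v hv =>
      Finset.mem_union_left _ ((Set.Finite.mem_toFinset hsupp).2 hv)
  have hle : ∏ᶠ v, g v ≤ ∏ v : S, g v := by
    rw [hT, ← Finset.prod_sdiff (Finset.subset_union_right : S.toFinset ⊆ T),
      Finset.prod_set_coe (f := g)]
    refine mul_le_of_le_one_left (Finset.prod_nonneg fun v _ => AbsoluteValue.nonneg _ _)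
      (Finset.prod_le_one (fun v _ => AbsoluteValue.nonneg _ _) fun v hv => ?_)
    exact adicAbv_le_one_of_valuation_le_one
      (Set.integer_valuation_le_one S K x (by simpa using (Finset.mem_sdiff.1 hv).2))
  rw [← prod_norm_embeddings_mul_finprod_adicAbv hxK, prodAbs, Fintype.prod_sum_type]
  exact mul_le_mul_of_nonneg_left hle (Finset.prod_nonneg fun _ _ => norm_nonneg _)

end NumberField

section Formulas

variable (R : Type*) [CommRing R] {α : Type} {n : ℕ}

/-- A function given by a term of the divisibility language. -/
def IsDivTerm (t : (α ⊕ Fin n → R) → R) : Prop :=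
  ∃ τ : DivLang.Term (α ⊕ Fin n), ∀ v, τ.realize v = t v

/-- A predicate given by a positive-existential formula of the divisibility language. -/
def IsPosExPred (P : (α ⊕ Fin n → R) → Prop) : Prop :=
  ∃ φ : DivLang.BoundedFormula α n, PosEx φ ∧ ∀ v xs, φ.Realize v xs ↔ P (Sum.elim v xs)

variable {R}

lemma IsDivTerm.var (i : α ⊕ Fin n) : IsDivTerm R fun v => v i := ⟨.var i, fun _ => rfl⟩

lemma IsDivTerm.zero : IsDivTerm R fun _ : α ⊕ Fin n → R => 0 :=
  ⟨.func (l := 0) (show Fin 2 from 0) ![], fun _ => rfl⟩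

lemma IsDivTerm.one : IsDivTerm R fun _ : α ⊕ Fin n → R => 1 :=
  ⟨.func (l := 0) (show Fin 2 from 1) ![], fun _ => rfl⟩

lemma IsDivTerm.add {s t : (α ⊕ Fin n → R) → R} (hs : IsDivTerm R s) (ht : IsDivTerm R t) :
    IsDivTerm R fun v => s v + t v := by
  obtain ⟨σ, hσ⟩ := hs
  obtain ⟨τ, hτ⟩ := ht
  refine ⟨.func (l := 2) () ![σ, τ], fun v => ?_⟩
  change _ = s v + t v
  rw [← hσ, ← hτ]
  rfl

lemma IsDivTerm.nsmul {t : (α ⊕ Fin n → R) → R} (ht : IsDivTerm R t) (a : ℕ) :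
    IsDivTerm R fun v => a • t v := by
  induction a with
  | zero => simpa using IsDivTerm.zero
  | succ a ih => simpa only [succ_nsmul] using ih.add ht

lemma IsDivTerm.natCast (a : ℕ) : IsDivTerm R fun _ : α ⊕ Fin n → R => (a : R) := by
  simpa using IsDivTerm.one.nsmul (R := R) (α := α) (n := n) a

lemma IsDivTerm.dvd {s t : (α ⊕ Fin n → R) → R} (hs : IsDivTerm R s) (ht : IsDivTerm R t) :
    IsPosExPred R fun v => s v ∣ t v := by
  obtain ⟨σ, hσ⟩ := hs
  obtain ⟨τ, hτ⟩ := ht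
  refine ⟨.rel (l := 2) () ![σ, τ], PosEx.rel _ _, fun v xs => ?_⟩
  change _ ↔ s (Sum.elim v xs) ∣ t (Sum.elim v xs)
  rw [← hσ, ← hτ]
  rfl

lemma IsPosExPred.and {P Q : (α ⊕ Fin n → R) → Prop} (hP : IsPosExPred R P)
    (hQ : IsPosExPred R Q) : IsPosExPred R fun v => P v ∧ Q v := by
  obtain ⟨φ, hφ, hφ'⟩ := hP
  obtain ⟨ψ, hψ, hψ'⟩ := hQ
  exact ⟨φ ⊓ ψ, hφ.inf hψ, fun v xs => by
    rw [Language.BoundedFormula.realize_inf, hφ', hψ']⟩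

lemma IsPosExPred.forall_mem {β : Type*} (A : Finset β) {P : β → (α ⊕ Fin n → R) → Prop}
    (hP : ∀ a, IsPosExPred R (P a)) : IsPosExPred R fun v => ∀ a ∈ A, P a v := by
  classical
  induction A using Finset.induction_on with
  | empty => simpa using IsDivTerm.one.dvd (R := R) (α := α) (n := n) IsDivTerm.one
  | insert a A ha ih => simpa only [Finset.forall_mem_insert] using (hP a).and ih

lemma IsPosExPred.exists {P : (α ⊕ Fin 1 → R) → Prop} (hP : IsPosExPred R P) :
    ∃ φ : DivLang.Formula α, PosEx φ ∧
      ∀ v : α → R, φ.Realize v ↔ ∃ t, P (Sum.elim v fun _ => t) := by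
  obtain ⟨φ, hφ, hφ'⟩ := hP
  refine ⟨φ.ex, hφ.ex, fun v => ?_⟩
  rw [Language.Formula.Realize, Language.BoundedFormula.realize_ex]
  refine exists_congr fun t => ?_
  rw [hφ']
  have : (Fin.snoc default t : Fin 1 → R) = fun _ => t := by
    funext i
    rw [Fin.fin_one_eq_zero i]
    rfl
  rw [this]

end Formulas

/-- the graph of multiplication restricted to units of `O_{K,S}` is
positive-existentially definable in the language `{=, 0, 1, +, ∣}`. -/
theorem prod_units_posEx_definable {K : Type*} [Field K] [NumberField K]
    (hdeg : Module.finrank ℚ K = 2) (himg : IsEmpty (K →+* ℝ))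
    (S : Set (HeightOneSpectrum (𝓞 K))) (hSfin : S.Finite) (hSne : S.Nonempty) :
    ∃ φ : DivLang.Formula (Fin 3), PosEx φ ∧
      ∀ v : Fin 3 → S.integer K,
        φ.Realize v ↔ (IsUnit (v 0) ∧ IsUnit (v 1) ∧ IsUnit (v 2) ∧ v 2 = v 0 * v 1) := by
  have : Fintype S := hSfin.fintype
  obtain ⟨σ⟩ : Nonempty (K →ₐ[ℚ] ℂ) := ⟨IsAlgClosed.lift⟩
  have hσ (n : ℕ) : integerAbs S (.inl σ) (n : S.integer K) = n := by
    simp [integerAbs_inl]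
  obtain ⟨A, hA⟩ := exists_finset_isUnit_mul_iff (one_le_prodAbs_integerAbs S) hσ
  have var (i : Fin 3) : IsDivTerm (S.integer K) fun v : Fin 3 ⊕ Fin 1 → _ => v (.inl i) :=
    .var (.inl i)
  have aux : IsDivTerm (S.integer K) fun v : Fin 3 ⊕ Fin 1 → _ => v (.inr 0) := .var (.inr 0)
  obtain ⟨φ, hφ, hφ'⟩ := IsPosExPred.exists <|
    (((var 0).dvd .one).and <| ((var 1).dvd .one).and <| (var 2).dvd .one).and <|
    IsPosExPred.forall_mem A fun a =>
      ((((var 1).add (.natCast a)).dvd (.add .one (aux.nsmul a))).and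
        ((aux.add (.natCast a)).dvd (.add .one ((var 1).nsmul a)))).and <|
      ((((var 0).add (.natCast a)).dvd ((var 2).add ((var 1).nsmul a))).and
        (((var 1).add (.natCast a)).dvd ((var 2).add ((var 0).nsmul a)))).and <|
      ((var 2).add (.natCast a)).dvd ((var 0).add (aux.nsmul a))
  exact ⟨φ, hφ, fun v => (hφ' v).trans (hA (v 0) (v 1) (v 2))⟩
end
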